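/- For every y = (a,b) ∈ E, the reflection with respect to M satisfies R_M(y) = [(I+P)y]⁺ − y; explicitly, R_M(a,b) = (r,s), where for each i, rᵢ = max(aᵢ + bᵢ, 0) − aᵢ and sᵢ = max(aᵢ + bᵢ, 0) − bᵢ. -/

import Mathlib

open RealInnerProductSpace

/-- The product space `E = ℝ^m × ℝ^m` with the ℓ²-product inner product and norm. -/
abbrev E (m : ℕ) : Type :=
  WithLp 2 (EuclideanSpace ℝ (Fin m) × EuclideanSpace ℝ (Fin m))

/-- The pairing map `(a, b) ↦ (a, b) ∈ E`. -/
noncomputable def mkE {m : ℕ} (a b : EuclideanSpace ℝ (Fin m)) : E m :=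
  (WithLp.equiv 2 _).symm (a, b)

/-- The set `M = {(u,u) : u ∈ ℝ^m, uᵢ ≥ 0 for all i}`. -/
def Mset (m : ℕ) : Set (E m) :=
  {y | ∃ u : EuclideanSpace ℝ (Fin m), (∀ i, 0 ≤ u i) ∧ y = mkE u u}

theorem norm_mkE_sub_mkE_sq {m : ℕ} (u v a b : EuclideanSpace ℝ (Fin m)) :
    ‖mkE u v - mkE a b‖ ^ 2 = ∑ i, ((u i - a i) ^ 2 + (v i - b i) ^ 2) := by
  rw [WithLp.prod_norm_sq_eq_of_L2, EuclideanSpace.norm_sq_eq, EuclideanSpace.norm_sq_eq,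
    ← Finset.sum_add_distrib]
  simp [mkE]

theorem sq_add_sq_add_le_of_nonneg {x : ℝ} (hx : 0 ≤ x) (a b : ℝ) :
    (max (a + b) 0 / 2 - a) ^ 2 + (max (a + b) 0 / 2 - b) ^ 2 + 2 * (x - max (a + b) 0 / 2) ^ 2 ≤
      (x - a) ^ 2 + (x - b) ^ 2 := by
  rcases le_total (a + b) 0 with h | h
  · rw [max_eq_right h]
    nlinarith [mul_nonneg hx (neg_nonneg.2 h)]
  · rw [max_eq_left h]
    nlinarith

/-- A nearest point `(u, u)` of `M` to `(a, b)` has `uᵢ = max (aᵢ + bᵢ) 0 / 2`. -/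
theorem eq_max_div_two_of_nearest {m : ℕ} {u a b : EuclideanSpace ℝ (Fin m)} (hu : ∀ i, 0 ≤ u i)
    (hmin : ∀ v ∈ Mset m, ‖mkE u u - mkE a b‖ ≤ ‖v - mkE a b‖) (i : Fin m) :
    u i = max (a i + b i) 0 / 2 := by
  let c : EuclideanSpace ℝ (Fin m) := WithLp.toLp 2 fun i => max (a i + b i) 0 / 2
  have hc : mkE c c ∈ Mset m := ⟨c, fun j => div_nonneg (le_max_right _ _) zero_le_two, rfl⟩
  have hle := pow_le_pow_left₀ (norm_nonneg _) (hmin _ hc) 2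
  rw [norm_mkE_sub_mkE_sq, norm_mkE_sub_mkE_sq] at hle
  have hsum := Finset.sum_le_sum fun j (_ : j ∈ Finset.univ) =>
    sq_add_sq_add_le_of_nonneg (hu j) (a j) (b j)
  rw [Finset.sum_add_distrib] at hsum
  have hsingle := Finset.single_le_sum (f := fun j => 2 * (u j - max (a j + b j) 0 / 2) ^ 2)
    (fun j _ => by positivity) (Finset.mem_univ i)
  have hsq : (u i - max (a i + b i) 0 / 2) ^ 2 ≤ 0 := by
    dsimp only [c] at hle hsingle
    linarith
  exact sub_eq_zero.1 (pow_eq_zero_iff two_ne_zero |>.1 (le_antisymm hsq (sq_nonneg _)))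

/-- For any map `proj` realising the orthogonal projection onto `M` (nearest point in `M`),
the reflection `R_M = 2 Π_M − I` satisfies `R_M(y) = [(I+P)y]⁺ − y`; explicitly
`R_M(a,b) = (r,s)` with `rᵢ = max(aᵢ+bᵢ,0) − aᵢ` and `sᵢ = max(aᵢ+bᵢ,0) − bᵢ`. -/
theorem stmt_2 (m : ℕ) (hm : 0 < m) (proj : E m → E m)
    (hproj : ∀ y : E m, proj y ∈ Mset m ∧ ∀ u ∈ Mset m, ‖proj y - y‖ ≤ ‖u - y‖)
    (a b : EuclideanSpace ℝ (Fin m)) :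
    (2 : ℝ) • proj (mkE a b) - mkE a b =
      mkE ((WithLp.equiv 2 _).symm fun i => max (a i + b i) 0 - a i)
          ((WithLp.equiv 2 _).symm fun i => max (a i + b i) 0 - b i) := by
  obtain ⟨⟨u, hu, hproj_eq⟩, hmin⟩ := hproj (mkE a b)
  rw [hproj_eq] at hmin ⊢
  have hu_eq := eq_max_div_two_of_nearest hu hmin
  apply (WithLp.equiv 2 _).injective
  refine Prod.ext ?_ ?_ <;> ext i <;> simp [mkE, hu_eq i] <;> ring
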